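/- arXiv:1909.03419 — 2 statements merged into one kernel-verified Lean document; each statement's English description precedes it below -/
import Mathlib

section
/- Assume ξ_i ≥ 0, ξ_j ≥ 0, ξ_k ≥ 0. For any fixed positive reals r_j, r_k, the hyperbolic triangle area function r_i ↦ π − ϑ_i(r_i, r_j, r_k) − ϑ_j(r_i, r_j, r_k) − ϑ_k(r_i, r_j, r_k) is strictly increasing on (0, ∞), and the function r_i ↦ ϑ_i(r_i, r_j, r_k) is strictly decreasing on (0, ∞). -/
/-- `hypCosh I rj rk` is the hyperbolic cosine of the side length `l_i` of
the hyperbolic three-circle configuration: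
`cosh l_i = cosh r_j · cosh r_k + I_i · sinh r_j · sinh r_k`. -/
noncomputable def hypCosh (I rj rk : ℝ) : ℝ :=
  Real.cosh rj * Real.cosh rk + I * Real.sinh rj * Real.sinh rk

/-- The hyperbolic inner angle `ϑ_i` at the center of the circle of radius `r_i`
in the hyperbolic three-circle configuration with radii `r_i, r_j, r_k` and
cosines of exterior intersection angles `I_i, I_j, I_k`:
`ϑ_i = arccos((cosh l_j · cosh l_k − cosh l_i)/(sinh l_j · sinh l_k))`,
where `sinh l = √(cosh² l − 1)` since `l > 0`.  The angles `ϑ_j, ϑ_k` are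
obtained by cyclic permutation of the arguments. -/
noncomputable def hypAngle (Ii Ij Ik ri rj rk : ℝ) : ℝ :=
  Real.arccos ((hypCosh Ij rk ri * hypCosh Ik ri rj - hypCosh Ii rj rk) /
    (Real.sqrt (hypCosh Ij rk ri ^ 2 - 1) * Real.sqrt (hypCosh Ik ri rj ^ 2 - 1)))


/-- Derivative of an angle of a hyperbolic triangle in terms of the cosh of the sides. -/
lemma angle_hasDerivAt (X Y Z : ℝ → ℝ) (X' Y' Z' x Δ : ℝ)
    (hX : HasDerivAt X X' x) (hY : HasDerivAt Y Y' x) (hZ : HasDerivAt Z Z' x)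
    (hy : 0 < Y x ^ 2 - 1) (hz : 0 < Z x ^ 2 - 1)
    (hΔ : Δ = 1 + 2 * X x * Y x * Z x - X x ^ 2 - Y x ^ 2 - Z x ^ 2) (hpos : 0 < Δ) :
    HasDerivAt (fun s => Real.arccos ((Y s * Z s - X s) /
        (Real.sqrt (Y s ^ 2 - 1) * Real.sqrt (Z s ^ 2 - 1))))
      ((X' - Y' * (X x * Y x - Z x) / (Y x ^ 2 - 1) - Z' * (X x * Z x - Y x) / (Z x ^ 2 - 1))
        / Real.sqrt Δ) x := by
  have hsy : 0 < Real.sqrt (Y x ^ 2 - 1) := Real.sqrt_pos.2 hy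
  have hsz : 0 < Real.sqrt (Z x ^ 2 - 1) := Real.sqrt_pos.2 hz
  have hsd : 0 < Real.sqrt Δ := Real.sqrt_pos.2 hpos
  have ey : Real.sqrt (Y x ^ 2 - 1) ^ 2 = Y x ^ 2 - 1 := Real.sq_sqrt hy.le
  have ez : Real.sqrt (Z x ^ 2 - 1) ^ 2 = Z x ^ 2 - 1 := Real.sq_sqrt hz.le
  have ed : Real.sqrt Δ ^ 2 = Δ := Real.sq_sqrt hpos.le
  have dY := ((hY.pow 2).sub_const 1).sqrt hy.ne'
  have dZ := ((hZ.pow 2).sub_const 1).sqrt hz.ne'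
  have dq := ((hY.mul hZ).sub hX).div (dY.mul dZ) (mul_pos hsy hsz).ne'
  set p := Real.sqrt (Y x ^ 2 - 1) with hp
  set q := Real.sqrt (Z x ^ 2 - 1) with hq
  set d := Real.sqrt Δ with hd
  have h1 : 1 - ((Y x * Z x - X x) / (p * q)) ^ 2 = (d / (p * q)) ^ 2 := by
    rw [div_pow, div_pow, mul_pow, ey, ez, ed, hΔ]
    field_simp
    ring
  have h1pos : 0 < (d / (p * q)) ^ 2 := by positivity
  have hne1 : (Y x * Z x - X x) / (p * q) ≠ -1 := by
    intro h
    rw [h] at h1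
    norm_num at h1
    linarith
  have hne2 : (Y x * Z x - X x) / (p * q) ≠ 1 := by
    intro h
    rw [h] at h1
    norm_num at h1
    linarith
  have da := (Real.hasDerivAt_arccos hne1 hne2).comp x dq
  refine da.congr_deriv ?_
  simp only [Pi.mul_apply, Pi.sub_apply, Pi.pow_apply, ← hp, ← hq]
  rw [h1, Real.sqrt_sq (by positivity), ← ey, ← ez]
  have ey' : Y x ^ 2 = p ^ 2 + 1 := by linarith
  have ez' : Z x ^ 2 = q ^ 2 + 1 := by linarith
  field_simp
  simp only [Nat.cast_ofNat, Nat.reduceSub, pow_one]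
  generalize Y x = y at *
  generalize Z x = z at *
  generalize X x = w at *
  rw [ey, ez]
  ring

/-- Homogeneous form of the area identity. -/
lemma area_identity (a b c p q n pj qj nj pk qk nk C S Cj Sj Ck Sk A B D B1 D1 : ℝ)
    (hn : n = p ^ 2 - q ^ 2) (hnj : nj = pj ^ 2 - qj ^ 2) (hnk : nk = pk ^ 2 - qk ^ 2)
    (hC : C = p ^ 2 + q ^ 2) (hS : S = 2 * p * q)
    (hCj : Cj = pj ^ 2 + qj ^ 2) (hSj : Sj = 2 * pj * qj)
    (hCk : Ck = pk ^ 2 + qk ^ 2) (hSk : Sk = 2 * pk * qk)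
    (hA : A = Cj * Ck + a * Sj * Sk) (hB : B = Ck * C + b * Sk * S)
    (hD : D = C * Cj + c * S * Sj)
    (hB1 : B1 = Ck * S + b * Sk * C) (hD1 : D1 = S * Cj + c * C * Sj) :
    B1 * (A * n + D * nk - B * nj - n * nj * nk) * (D + n * nj)
      + D1 * (A * n + B * nj - D * nk - n * nj * nk) * (B + n * nk) =
    16 * n *
     ((c + a * b) * (qj * pj ^ 3 * qk ^ 2 * pk ^ 2 * p ^ 2 * (p ^ 2 + 3 * q ^ 2)
        + qj ^ 3 * pj * qk ^ 2 * pk ^ 2 * q ^ 2 * (3 * p ^ 2 + q ^ 2))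
      + (b + a * c) * (qk * pk ^ 3 * qj ^ 2 * pj ^ 2 * p ^ 2 * (p ^ 2 + 3 * q ^ 2)
        + qk ^ 3 * pk * qj ^ 2 * pj ^ 2 * q ^ 2 * (3 * p ^ 2 + q ^ 2))
      + (1 - b ^ 2) * (p ^ 3 * q * pj ^ 4 * pk ^ 2 * qk ^ 2 + p * q ^ 3 * qj ^ 4 * pk ^ 2 * qk ^ 2)
      + (1 - c ^ 2) * (p ^ 3 * q * pk ^ 4 * pj ^ 2 * qj ^ 2 + p * q ^ 3 * qk ^ 4 * pj ^ 2 * qj ^ 2)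
      + (a + b * c) * (2 * p ^ 3 * q * pj ^ 3 * qj * pk ^ 3 * qk
        + p * q * (p ^ 2 + q ^ 2) * (pj ^ 3 * qj * pk * qk ^ 3 + pj * qj ^ 3 * pk ^ 3 * qk)
        + 2 * p * q ^ 3 * pj * qj ^ 3 * pk * qk ^ 3)
      + (2 + b ^ 2 + c ^ 2 + 4 * a * b * c)
        * (p * q * (p ^ 2 + q ^ 2) * pj ^ 2 * qj ^ 2 * pk ^ 2 * qk ^ 2)) := by
  subst hB1 hD1 hA hB hD
  subst hC hS hCj hSj hCk hSk hn hnj hnk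
  ring

lemma coef1 (a b c : ℝ) (ha : -1 < a) (ha' : a ≤ 1) (hb : -1 < b) (hb' : b ≤ 1)
    (hc : -1 < c) (hc' : c ≤ 1) : 0 < 2 + b ^ 2 + c ^ 2 + 4 * a * b * c := by
  rcases le_or_gt 0 (b * c) with h | h
  · rcases h.eq_or_lt with h | h
    · have : a * (b * c) = 0 := by rw [← h, mul_zero]
      nlinarith [sq_nonneg b, sq_nonneg c]
    · have h1 : 0 < (1 + a) * (b * c) := mul_pos (by linarith) h
      have h2 : b * c ≤ 1 := by nlinarith
      nlinarith [sq_nonneg (b - c)]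
  · have h1 : 0 ≤ (1 - a) * (-(b * c)) := mul_nonneg (by linarith) (by linarith)
    have h2 : -1 < b * c := by
      rcases lt_or_ge b 0 with hb0 | hb0
      · have : 0 < c := by nlinarith
        nlinarith
      · have : c < 0 := by nlinarith
        nlinarith
    nlinarith [sq_nonneg (b + c)]

lemma coef3 (a b c : ℝ) (ha : -1 < a) (ha' : a ≤ 1) (hb : -1 < b) (hb' : b ≤ 1)
    (hc : -1 < c) (hc' : c ≤ 1) : 0 < 1 + a * b * c := by
  have h1 : -1 < a * b := by
    rcases lt_or_ge a 0 with h | h <;> nlinarith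
  have h2 : a * b ≤ 1 := by
    rcases lt_or_ge a 0 with h | h <;> nlinarith
  rcases lt_or_ge (a * b) 0 with h | h <;> nlinarith

lemma delta_identity (a b c p q n pj qj nj pk qk nk C S Cj Sj Ck Sk A B D B1 D1 : ℝ)
    (hn : n = p ^ 2 - q ^ 2) (hnj : nj = pj ^ 2 - qj ^ 2) (hnk : nk = pk ^ 2 - qk ^ 2)
    (hC : C = p ^ 2 + q ^ 2) (hS : S = 2 * p * q)
    (hCj : Cj = pj ^ 2 + qj ^ 2) (hSj : Sj = 2 * pj * qj)
    (hCk : Ck = pk ^ 2 + qk ^ 2) (hSk : Sk = 2 * pk * qk)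
    (hA : A = Cj * Ck + a * Sj * Sk) (hB : B = Ck * C + b * Sk * S)
    (hD : D = C * Cj + c * S * Sj)
    (hB1 : B1 = Ck * S + b * Sk * C) (hD1 : D1 = S * Cj + c * C * Sj) :
    n ^ 2 * nj ^ 2 * nk ^ 2 + 2 * A * B * D - A ^ 2 * n ^ 2 - B ^ 2 * nj ^ 2 - D ^ 2 * nk ^ 2 =
      Sj ^ 2 * Sk ^ 2 * n ^ 2 * (1 - a ^ 2) + Sk ^ 2 * S ^ 2 * nj ^ 2 * (1 - b ^ 2)
      + S ^ 2 * Sj ^ 2 * nk ^ 2 * (1 - c ^ 2) + 2 * (1 + a * b * c) * (S ^ 2 * Sj ^ 2 * Sk ^ 2)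
      + 2 * (a + b * c) * (Cj * Ck * S ^ 2 * Sj * Sk)
      + 2 * (b + c * a) * (Ck * C * Sj ^ 2 * Sk * S)
      + 2 * (c + a * b) * (C * Cj * Sk ^ 2 * S * Sj) := by
  subst hB1 hD1 hA hB hD
  subst hC hS hCj hSj hCk hSk hn hnj hnk
  ring

lemma angj_identity (a b c p q n pj qj nj pk qk nk C S Cj Sj Ck Sk A B D B1 D1 : ℝ)
    (hn : n = p ^ 2 - q ^ 2) (hnj : nj = pj ^ 2 - qj ^ 2) (hnk : nk = pk ^ 2 - qk ^ 2)
    (hC : C = p ^ 2 + q ^ 2) (hS : S = 2 * p * q)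
    (hCj : Cj = pj ^ 2 + qj ^ 2) (hSj : Sj = 2 * pj * qj)
    (hCk : Ck = pk ^ 2 + qk ^ 2) (hSk : Sk = 2 * pk * qk)
    (hA : A = Cj * Ck + a * Sj * Sk) (hB : B = Ck * C + b * Sk * S)
    (hD : D = C * Cj + c * S * Sj)
    (hB1 : B1 = Ck * S + b * Sk * C) (hD1 : D1 = S * Cj + c * C * Sj) :
    B1 * (D ^ 2 - n ^ 2 * nj ^ 2) - (B * D - A * n ^ 2) * D1 =
      n ^ 2 * (Ck * S * Sj ^ 2 * (1 - c ^ 2) + C * Sj ^ 2 * Sk * (b + c * a)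
        + Cj * S * Sj * Sk * (a + b * c)) := by
  subst hB1 hD1 hA hB hD
  subst hC hS hCj hSj hCk hSk hn hnj hnk
  ring

lemma angk_identity (a b c p q n pj qj nj pk qk nk C S Cj Sj Ck Sk A B D B1 D1 : ℝ)
    (hn : n = p ^ 2 - q ^ 2) (hnj : nj = pj ^ 2 - qj ^ 2) (hnk : nk = pk ^ 2 - qk ^ 2)
    (hC : C = p ^ 2 + q ^ 2) (hS : S = 2 * p * q)
    (hCj : Cj = pj ^ 2 + qj ^ 2) (hSj : Sj = 2 * pj * qj)
    (hCk : Ck = pk ^ 2 + qk ^ 2) (hSk : Sk = 2 * pk * qk)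
    (hA : A = Cj * Ck + a * Sj * Sk) (hB : B = Ck * C + b * Sk * S)
    (hD : D = C * Cj + c * S * Sj)
    (hB1 : B1 = Ck * S + b * Sk * C) (hD1 : D1 = S * Cj + c * C * Sj) :
    D1 * (B ^ 2 - n ^ 2 * nk ^ 2) - (B * D - A * n ^ 2) * B1 =
      n ^ 2 * (Cj * S * Sk ^ 2 * (1 - b ^ 2) + C * Sk ^ 2 * Sj * (c + a * b)
        + Ck * S * Sj * Sk * (a + b * c)) := by
  subst hB1 hD1 hA hB hD
  subst hC hS hCj hSj hCk hSk hn hnj hnk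
  ring

lemma sq_le_aux (a : ℝ) (h : -1 < a) (h' : a ≤ 1) : 0 ≤ 1 - a ^ 2 := by nlinarith

/-- The area inequality. -/
lemma area_pos (a b c x y z A B D B1 D1 : ℝ) (hx : 0 < x) (hy : 0 < y) (hz : 0 < z)
    (ha : -1 < a) (ha' : a ≤ 1) (hb : -1 < b) (hb' : b ≤ 1)
    (hc : -1 < c) (hc' : c ≤ 1)
    (h1 : 0 ≤ a + b * c) (h2 : 0 ≤ b + c * a) (h3 : 0 ≤ c + a * b)
    (hA : A = Real.cosh y * Real.cosh z + a * Real.sinh y * Real.sinh z)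
    (hB : B = Real.cosh z * Real.cosh x + b * Real.sinh z * Real.sinh x)
    (hD : D = Real.cosh x * Real.cosh y + c * Real.sinh x * Real.sinh y)
    (hB1 : B1 = Real.cosh z * Real.sinh x + b * Real.sinh z * Real.cosh x)
    (hD1 : D1 = Real.sinh x * Real.cosh y + c * Real.cosh x * Real.sinh y) :
    0 < B1 * (A + D - B - 1) * (D + 1) + D1 * (A + B - D - 1) * (B + 1) := by
  have key : ∀ r : ℝ, 1 = Real.cosh (r / 2) ^ 2 - Real.sinh (r / 2) ^ 2 ∧
      Real.cosh r = Real.cosh (r / 2) ^ 2 + Real.sinh (r / 2) ^ 2 ∧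
      Real.sinh r = 2 * Real.cosh (r / 2) * Real.sinh (r / 2) := by
    intro r
    refine ⟨(Real.cosh_sq_sub_sinh_sq _).symm, ?_, ?_⟩
    · rw [← Real.cosh_two_mul]; congr 1; ring
    · rw [mul_right_comm, ← Real.sinh_two_mul]; congr 1; ring
  obtain ⟨x1, x2, x3⟩ := key x
  obtain ⟨y1, y2, y3⟩ := key y
  obtain ⟨z1, z2, z3⟩ := key z
  have id := area_identity a b c _ _ 1 _ _ 1 _ _ 1 _ _ _ _ _ _ A B D B1 D1
    x1 y1 z1 x2 x3 y2 y3 z2 z3 hA hB hD hB1 hD1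
  simp only [mul_one] at id
  rw [id]
  have px := Real.cosh_pos (x / 2)
  have py := Real.cosh_pos (y / 2)
  have pz := Real.cosh_pos (z / 2)
  have qx := Real.sinh_pos_iff.2 (half_pos hx)
  have qy := Real.sinh_pos_iff.2 (half_pos hy)
  have qz := Real.sinh_pos_iff.2 (half_pos hz)
  have k := coef1 a b c ha ha' hb hb' hc hc'
  have kb : 0 ≤ 1 - b ^ 2 := sq_le_aux b hb hb'
  have kc : 0 ≤ 1 - c ^ 2 := sq_le_aux c hc hc'
  have h2' : 0 ≤ b + a * c := by linarith
  positivity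

lemma delta_pos (a b c x y z A B D B1 D1 : ℝ) (hx : 0 < x) (hy : 0 < y) (hz : 0 < z)
    (ha : -1 < a) (ha' : a ≤ 1) (hb : -1 < b) (hb' : b ≤ 1)
    (hc : -1 < c) (hc' : c ≤ 1)
    (h1 : 0 ≤ a + b * c) (h2 : 0 ≤ b + c * a) (h3 : 0 ≤ c + a * b)
    (hA : A = Real.cosh y * Real.cosh z + a * Real.sinh y * Real.sinh z)
    (hB : B = Real.cosh z * Real.cosh x + b * Real.sinh z * Real.sinh x)
    (hD : D = Real.cosh x * Real.cosh y + c * Real.sinh x * Real.sinh y)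
    (hB1 : B1 = Real.cosh z * Real.sinh x + b * Real.sinh z * Real.cosh x)
    (hD1 : D1 = Real.sinh x * Real.cosh y + c * Real.cosh x * Real.sinh y) :
    0 < 1 + 2 * A * B * D - A ^ 2 - B ^ 2 - D ^ 2 := by
  have key : ∀ r : ℝ, 1 = Real.cosh (r / 2) ^ 2 - Real.sinh (r / 2) ^ 2 ∧
      Real.cosh r = Real.cosh (r / 2) ^ 2 + Real.sinh (r / 2) ^ 2 ∧
      Real.sinh r = 2 * Real.cosh (r / 2) * Real.sinh (r / 2) := by
    intro r
    refine ⟨(Real.cosh_sq_sub_sinh_sq _).symm, ?_, ?_⟩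
    · rw [← Real.cosh_two_mul]; congr 1; ring
    · rw [mul_right_comm, ← Real.sinh_two_mul]; congr 1; ring
  obtain ⟨x1, x2, x3⟩ := key x
  obtain ⟨y1, y2, y3⟩ := key y
  obtain ⟨z1, z2, z3⟩ := key z
  have id := delta_identity a b c _ _ 1 _ _ 1 _ _ 1 _ _ _ _ _ _ A B D B1 D1
    x1 y1 z1 x2 x3 y2 y3 z2 z3 hA hB hD hB1 hD1
  simp only [mul_one, one_pow, one_mul] at id
  rw [id]
  have px := Real.cosh_pos (x / 2)
  have py := Real.cosh_pos (y / 2)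
  have pz := Real.cosh_pos (z / 2)
  have qx := Real.sinh_pos_iff.2 (half_pos hx)
  have qy := Real.sinh_pos_iff.2 (half_pos hy)
  have qz := Real.sinh_pos_iff.2 (half_pos hz)
  have k : 0 < 1 + a * b * c := by
    have := coef3 a b c ha ha' hb hb' hc hc'
    linarith
  have Qx := Real.sinh_pos_iff.2 hx
  have Qy := Real.sinh_pos_iff.2 hy
  have Qz := Real.sinh_pos_iff.2 hz
  have Px := Real.cosh_pos x
  have Py := Real.cosh_pos y
  have Pz := Real.cosh_pos z
  have ka : 0 ≤ 1 - a ^ 2 := sq_le_aux a ha ha'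
  have kb : 0 ≤ 1 - b ^ 2 := sq_le_aux b hb hb'
  have kc : 0 ≤ 1 - c ^ 2 := sq_le_aux c hc hc'
  have h2' : 0 ≤ b + a * c := by linarith
  positivity

lemma angj_pos (a b c x y z A B D B1 D1 : ℝ) (hx : 0 < x) (hy : 0 < y) (hz : 0 < z)
    (ha : -1 < a) (ha' : a ≤ 1) (hb : -1 < b) (hb' : b ≤ 1)
    (hc : -1 < c) (hc' : c ≤ 1)
    (h1 : 0 ≤ a + b * c) (h2 : 0 ≤ b + c * a) (h3 : 0 ≤ c + a * b)
    (hA : A = Real.cosh y * Real.cosh z + a * Real.sinh y * Real.sinh z)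
    (hB : B = Real.cosh z * Real.cosh x + b * Real.sinh z * Real.sinh x)
    (hD : D = Real.cosh x * Real.cosh y + c * Real.sinh x * Real.sinh y)
    (hB1 : B1 = Real.cosh z * Real.sinh x + b * Real.sinh z * Real.cosh x)
    (hD1 : D1 = Real.sinh x * Real.cosh y + c * Real.cosh x * Real.sinh y) :
    0 ≤ B1 * (D ^ 2 - 1) - (B * D - A) * D1 := by
  have key : ∀ r : ℝ, 1 = Real.cosh (r / 2) ^ 2 - Real.sinh (r / 2) ^ 2 ∧
      Real.cosh r = Real.cosh (r / 2) ^ 2 + Real.sinh (r / 2) ^ 2 ∧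
      Real.sinh r = 2 * Real.cosh (r / 2) * Real.sinh (r / 2) := by
    intro r
    refine ⟨(Real.cosh_sq_sub_sinh_sq _).symm, ?_, ?_⟩
    · rw [← Real.cosh_two_mul]; congr 1; ring
    · rw [mul_right_comm, ← Real.sinh_two_mul]; congr 1; ring
  obtain ⟨x1, x2, x3⟩ := key x
  obtain ⟨y1, y2, y3⟩ := key y
  obtain ⟨z1, z2, z3⟩ := key z
  have id := angj_identity a b c _ _ 1 _ _ 1 _ _ 1 _ _ _ _ _ _ A B D B1 D1
    x1 y1 z1 x2 x3 y2 y3 z2 z3 hA hB hD hB1 hD1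
  simp only [mul_one, one_pow, one_mul] at id
  rw [id]
  have px := Real.cosh_pos (x / 2)
  have py := Real.cosh_pos (y / 2)
  have pz := Real.cosh_pos (z / 2)
  have qx := Real.sinh_pos_iff.2 (half_pos hx)
  have qy := Real.sinh_pos_iff.2 (half_pos hy)
  have qz := Real.sinh_pos_iff.2 (half_pos hz)
  have k : 0 < 1 + a * b * c := by
    have := coef3 a b c ha ha' hb hb' hc hc'
    linarith
  have Qx := Real.sinh_pos_iff.2 hx
  have Qy := Real.sinh_pos_iff.2 hy
  have Qz := Real.sinh_pos_iff.2 hz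
  have Px := Real.cosh_pos x
  have Py := Real.cosh_pos y
  have Pz := Real.cosh_pos z
  have ka : 0 ≤ 1 - a ^ 2 := sq_le_aux a ha ha'
  have kb : 0 ≤ 1 - b ^ 2 := sq_le_aux b hb hb'
  have kc : 0 ≤ 1 - c ^ 2 := sq_le_aux c hc hc'
  have h2' : 0 ≤ b + a * c := by linarith
  positivity

lemma angk_pos (a b c x y z A B D B1 D1 : ℝ) (hx : 0 < x) (hy : 0 < y) (hz : 0 < z)
    (ha : -1 < a) (ha' : a ≤ 1) (hb : -1 < b) (hb' : b ≤ 1)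
    (hc : -1 < c) (hc' : c ≤ 1)
    (h1 : 0 ≤ a + b * c) (h2 : 0 ≤ b + c * a) (h3 : 0 ≤ c + a * b)
    (hA : A = Real.cosh y * Real.cosh z + a * Real.sinh y * Real.sinh z)
    (hB : B = Real.cosh z * Real.cosh x + b * Real.sinh z * Real.sinh x)
    (hD : D = Real.cosh x * Real.cosh y + c * Real.sinh x * Real.sinh y)
    (hB1 : B1 = Real.cosh z * Real.sinh x + b * Real.sinh z * Real.cosh x)
    (hD1 : D1 = Real.sinh x * Real.cosh y + c * Real.cosh x * Real.sinh y) :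
    0 ≤ D1 * (B ^ 2 - 1) - (B * D - A) * B1 := by
  have key : ∀ r : ℝ, 1 = Real.cosh (r / 2) ^ 2 - Real.sinh (r / 2) ^ 2 ∧
      Real.cosh r = Real.cosh (r / 2) ^ 2 + Real.sinh (r / 2) ^ 2 ∧
      Real.sinh r = 2 * Real.cosh (r / 2) * Real.sinh (r / 2) := by
    intro r
    refine ⟨(Real.cosh_sq_sub_sinh_sq _).symm, ?_, ?_⟩
    · rw [← Real.cosh_two_mul]; congr 1; ring
    · rw [mul_right_comm, ← Real.sinh_two_mul]; congr 1; ring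
  obtain ⟨x1, x2, x3⟩ := key x
  obtain ⟨y1, y2, y3⟩ := key y
  obtain ⟨z1, z2, z3⟩ := key z
  have id := angk_identity a b c _ _ 1 _ _ 1 _ _ 1 _ _ _ _ _ _ A B D B1 D1
    x1 y1 z1 x2 x3 y2 y3 z2 z3 hA hB hD hB1 hD1
  simp only [mul_one, one_pow, one_mul] at id
  rw [id]
  have px := Real.cosh_pos (x / 2)
  have py := Real.cosh_pos (y / 2)
  have pz := Real.cosh_pos (z / 2)
  have qx := Real.sinh_pos_iff.2 (half_pos hx)
  have qy := Real.sinh_pos_iff.2 (half_pos hy)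
  have qz := Real.sinh_pos_iff.2 (half_pos hz)
  have k : 0 < 1 + a * b * c := by
    have := coef3 a b c ha ha' hb hb' hc hc'
    linarith
  have Qx := Real.sinh_pos_iff.2 hx
  have Qy := Real.sinh_pos_iff.2 hy
  have Qz := Real.sinh_pos_iff.2 hz
  have Px := Real.cosh_pos x
  have Py := Real.cosh_pos y
  have Pz := Real.cosh_pos z
  have ka : 0 ≤ 1 - a ^ 2 := sq_le_aux a ha ha'
  have kb : 0 ≤ 1 - b ^ 2 := sq_le_aux b hb hb'
  have kc : 0 ≤ 1 - c ^ 2 := sq_le_aux c hc hc'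
  have h2' : 0 ≤ b + a * c := by linarith
  positivity


lemma hypCosh_gt (I r s : ℝ) (hI : -1 < I) (hr : 0 < r) (hs : 0 < s) : 1 < hypCosh I r s := by
  have h1 := Real.one_le_cosh (r - s)
  rw [Real.cosh_sub] at h1
  have h2 : 0 < Real.sinh r * Real.sinh s :=
    mul_pos (Real.sinh_pos_iff.2 hr) (Real.sinh_pos_iff.2 hs)
  unfold hypCosh
  nlinarith

lemma final_ineq (A B D B1 D1 s : ℝ) (hs : 0 < s) (gB : 1 < B) (gD : 1 < D)
    (hF : 0 < B1 * (A + D - B - 1) * (D + 1) + D1 * (A + B - D - 1) * (B + 1))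
    (hJ : 0 ≤ B1 * (D ^ 2 - 1) - (B * D - A) * D1)
    (hK : 0 ≤ D1 * (B ^ 2 - 1) - (B * D - A) * B1) :
    0 < 0 - (0 - B1 * (A * B - D) / (B ^ 2 - 1) - D1 * (A * D - B) / (D ^ 2 - 1)) / s
        - (B1 - D1 * (B * D - A) / (D ^ 2 - 1) - 0 * (B * A - D) / (A ^ 2 - 1)) / s
        - (D1 - 0 * (D * A - B) / (A ^ 2 - 1) - B1 * (D * B - A) / (B ^ 2 - 1)) / s ∧
      (0 - B1 * (A * B - D) / (B ^ 2 - 1) - D1 * (A * D - B) / (D ^ 2 - 1)) / s < 0 := by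
  have gB2 : 0 < B ^ 2 - 1 := by nlinarith
  have gD2 : 0 < D ^ 2 - 1 := by nlinarith
  have gB1 : 0 < B - 1 := by linarith
  have gD1 : 0 < D - 1 := by linarith
  have gB3 : 0 < B + 1 := by linarith
  have gD3 : 0 < D + 1 := by linarith
  have fB : B ^ 2 - 1 = (B - 1) * (B + 1) := by ring
  have fD : D ^ 2 - 1 = (D - 1) * (D + 1) := by ring
  have e1 : 0 - (0 - B1 * (A * B - D) / (B ^ 2 - 1) - D1 * (A * D - B) / (D ^ 2 - 1)) / s
        - (B1 - D1 * (B * D - A) / (D ^ 2 - 1) - 0 * (B * A - D) / (A ^ 2 - 1)) / s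
        - (D1 - 0 * (D * A - B) / (A ^ 2 - 1) - B1 * (D * B - A) / (B ^ 2 - 1)) / s
      = (B1 * (A + D - B - 1) * (D + 1) + D1 * (A + B - D - 1) * (B + 1))
        / ((B + 1) * (D + 1) * s) := by
    rw [fB, fD]
    simp only [zero_mul, zero_div]
    field_simp
    ring
  have e2 : B1 - D1 * (B * D - A) / (D ^ 2 - 1) - 0 * (B * A - D) / (A ^ 2 - 1)
      = (B1 * (D ^ 2 - 1) - (B * D - A) * D1) / (D ^ 2 - 1) := by
    rw [zero_mul, zero_div]
    field_simp
    ring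
  have e3 : D1 - 0 * (D * A - B) / (A ^ 2 - 1) - B1 * (D * B - A) / (B ^ 2 - 1)
      = (D1 * (B ^ 2 - 1) - (B * D - A) * B1) / (B ^ 2 - 1) := by
    rw [zero_mul, zero_div]
    field_simp
    ring
  have p1 : 0 < 0 - (0 - B1 * (A * B - D) / (B ^ 2 - 1) - D1 * (A * D - B) / (D ^ 2 - 1)) / s
        - (B1 - D1 * (B * D - A) / (D ^ 2 - 1) - 0 * (B * A - D) / (A ^ 2 - 1)) / s
        - (D1 - 0 * (D * A - B) / (A ^ 2 - 1) - B1 * (D * B - A) / (B ^ 2 - 1)) / s := by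
    rw [e1]
    exact div_pos hF (by positivity)
  refine ⟨p1, ?_⟩
  have p2 : 0 ≤ (B1 - D1 * (B * D - A) / (D ^ 2 - 1) - 0 * (B * A - D) / (A ^ 2 - 1)) / s := by
    rw [e2]
    exact div_nonneg (div_nonneg hJ gD2.le) hs.le
  have p3 : 0 ≤ (D1 - 0 * (D * A - B) / (A ^ 2 - 1) - B1 * (D * B - A) / (B ^ 2 - 1)) / s := by
    rw [e3]
    exact div_nonneg (div_nonneg hK gB2.le) hs.le
  linarith

theorem stmt_8 (Θi Θj Θk : ℝ)
    (hi0 : 0 ≤ Θi) (hi1 : Θi < Real.pi)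
    (hj0 : 0 ≤ Θj) (hj1 : Θj < Real.pi)
    (hk0 : 0 ≤ Θk) (hk1 : Θk < Real.pi)
    (hξi : 0 ≤ Real.cos Θi + Real.cos Θj * Real.cos Θk)
    (hξj : 0 ≤ Real.cos Θj + Real.cos Θk * Real.cos Θi)
    (hξk : 0 ≤ Real.cos Θk + Real.cos Θi * Real.cos Θj)
    (rj rk : ℝ) (hrj : 0 < rj) (hrk : 0 < rk) :
    StrictMonoOn (fun ri =>
        Real.pi - hypAngle (Real.cos Θi) (Real.cos Θj) (Real.cos Θk) ri rj rk
          - hypAngle (Real.cos Θj) (Real.cos Θk) (Real.cos Θi) rj rk ri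
          - hypAngle (Real.cos Θk) (Real.cos Θi) (Real.cos Θj) rk ri rj)
      (Set.Ioi (0 : ℝ)) ∧
    StrictAntiOn (fun ri => hypAngle (Real.cos Θi) (Real.cos Θj) (Real.cos Θk) ri rj rk)
      (Set.Ioi (0 : ℝ)) := by
  set a := Real.cos Θi with hadef
  set b := Real.cos Θj with hbdef
  set c := Real.cos Θk with hcdef
  have hcos : ∀ θ : ℝ, 0 ≤ θ → θ < Real.pi → -1 < Real.cos θ := by
    intro θ h0 h1
    have := Real.strictAntiOn_cos ⟨h0, h1.le⟩ ⟨Real.pi_pos.le, le_refl _⟩ h1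
    rwa [Real.cos_pi] at this
  have ha : -1 < a := hcos _ hi0 hi1
  have hb : -1 < b := hcos _ hj0 hj1
  have hc : -1 < c := hcos _ hk0 hk1
  have ha' : a ≤ 1 := Real.cos_le_one _
  have hb' : b ≤ 1 := Real.cos_le_one _
  have hc' : c ≤ 1 := Real.cos_le_one _
  have hd : ∀ x ∈ Set.Ioi (0 : ℝ), ∃ di dj dk : ℝ,
      HasDerivAt (fun ri => hypAngle a b c ri rj rk) di x ∧
      HasDerivAt (fun ri => hypAngle b c a rj rk ri) dj x ∧
      HasDerivAt (fun ri => hypAngle c a b rk ri rj) dk x ∧ 0 < 0 - di - dj - dk ∧ di < 0 := by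
    intro x hx
    have hx : 0 < x := hx
    have gA : 1 < hypCosh a rj rk := hypCosh_gt a rj rk ha hrj hrk
    have gB : 1 < hypCosh b rk x := hypCosh_gt b rk x hb hrk hx
    have gD : 1 < hypCosh c x rj := hypCosh_gt c x rj hc hx hrj
    have dA : HasDerivAt (fun _ : ℝ => hypCosh a rj rk) 0 x := hasDerivAt_const _ _
    have dB : HasDerivAt (fun s : ℝ => hypCosh b rk s)
        (Real.cosh rk * Real.sinh x + b * Real.sinh rk * Real.cosh x) x :=
      ((Real.hasDerivAt_cosh x).const_mul _).add ((Real.hasDerivAt_sinh x).const_mul _)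
    have dD : HasDerivAt (fun s : ℝ => hypCosh c s rj)
        (Real.sinh x * Real.cosh rj + c * Real.cosh x * Real.sinh rj) x :=
      ((Real.hasDerivAt_cosh x).mul_const _).add
        (((Real.hasDerivAt_sinh x).const_mul c).mul_const _)
    have hF := area_pos a b c x rj rk (hypCosh a rj rk) (hypCosh b rk x) (hypCosh c x rj)
      _ _ hx hrj hrk ha ha' hb hb' hc hc' hξi hξj hξk
      rfl rfl rfl rfl rfl
    have hJ := angj_pos a b c x rj rk (hypCosh a rj rk) (hypCosh b rk x) (hypCosh c x rj)
      _ _ hx hrj hrk ha ha' hb hb' hc hc' hξi hξj hξk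
      rfl rfl rfl rfl rfl
    have hK := angk_pos a b c x rj rk (hypCosh a rj rk) (hypCosh b rk x) (hypCosh c x rj)
      _ _ hx hrj hrk ha ha' hb hb' hc hc' hξi hξj hξk
      rfl rfl rfl rfl rfl
    have hΔ := delta_pos a b c x rj rk (hypCosh a rj rk) (hypCosh b rk x) (hypCosh c x rj)
      _ _ hx hrj hrk ha ha' hb hb' hc hc' hξi hξj hξk
      rfl rfl rfl rfl rfl
    have gA2 : 0 < hypCosh a rj rk ^ 2 - 1 := by nlinarith
    have gB2 : 0 < hypCosh b rk x ^ 2 - 1 := by nlinarith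
    have gD2 : 0 < hypCosh c x rj ^ 2 - 1 := by nlinarith
    have ei := angle_hasDerivAt _ _ _ _ _ _ x _ dA dB dD gB2 gD2 rfl hΔ
    have ej := angle_hasDerivAt _ _ _ _ _ _ x _ dB dD dA gD2 gA2
      (by ring : 1 + 2 * hypCosh a rj rk * hypCosh b rk x * hypCosh c x rj - hypCosh a rj rk ^ 2
        - hypCosh b rk x ^ 2 - hypCosh c x rj ^ 2 = _) hΔ
    have ek := angle_hasDerivAt _ _ _ _ _ _ x _ dD dA dB gA2 gB2
      (by ring : 1 + 2 * hypCosh a rj rk * hypCosh b rk x * hypCosh c x rj - hypCosh a rj rk ^ 2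
        - hypCosh b rk x ^ 2 - hypCosh c x rj ^ 2 = _) hΔ
    refine ⟨_, _, _, ei, ej, ek, ?_⟩
    have hs := Real.sqrt_pos.2 hΔ
    generalize Real.sqrt (1 + 2 * hypCosh a rj rk * hypCosh b rk x * hypCosh c x rj
      - hypCosh a rj rk ^ 2 - hypCosh b rk x ^ 2 - hypCosh c x rj ^ 2) = s at *
    clear ei ej ek dA dB dD hΔ
    generalize hypCosh a rj rk = A at *
    generalize hypCosh b rk x = B at *
    generalize hypCosh c x rj = D at *
    generalize Real.cosh rk * Real.sinh x + b * Real.sinh rk * Real.cosh x = B1 at *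
    generalize Real.sinh x * Real.cosh rj + c * Real.cosh x * Real.sinh rj = D1 at *
    exact final_ineq A B D B1 D1 s hs gB gD hF hJ hK
  constructor
  · apply strictMonoOn_of_deriv_pos (convex_Ioi 0)
    · intro x hx
      obtain ⟨di, dj, dk, e1, e2, e3, -, -⟩ := hd x hx
      exact ((((hasDerivAt_const x Real.pi).sub e1).sub e2).sub e3).continuousAt.continuousWithinAt
    · intro x hx
      rw [interior_Ioi] at hx
      obtain ⟨di, dj, dk, e1, e2, e3, h, -⟩ := hd x hx
      have e := (((hasDerivAt_const x Real.pi).sub e1).sub e2).sub e3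
      have e' : deriv (fun ri => Real.pi - hypAngle a b c ri rj rk - hypAngle b c a rj rk ri
          - hypAngle c a b rk ri rj) x = 0 - di - dj - dk := e.deriv
      rw [e']
      exact h
  · apply strictAntiOn_of_deriv_neg (convex_Ioi 0)
    · intro x hx
      obtain ⟨di, dj, dk, e1, e2, e3, -, -⟩ := hd x hx
      exact e1.continuousAt.continuousWithinAt
    · intro x hx
      rw [interior_Ioi] at hx
      obtain ⟨di, dj, dk, e1, e2, e3, -, h⟩ := hd x hx
      rw [e1.deriv]
      exact h
end

section
/- Assume ξ_i ≥ 0, ξ_j ≥ 0, ξ_k ≥ 0. Then the sum of hyperbolic inner angles ϑ_i(r_i, r_j, r_k) + ϑ_j(r_i, r_j, r_k) + ϑ_k(r_i, r_j, r_k) tends to π as (r_i, r_j, r_k) tends to (0, 0, 0) within the open positive octant (0,∞)³. -/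
theorem aux_angle (a b c : ℝ) (hb : 1 < b) (hc : 1 < c)
    (hD : 0 ≤ 1 + 2 * a * b * c - a ^ 2 - b ^ 2 - c ^ 2) :
    Real.cos (Real.arccos ((b * c - a) / (√(b ^ 2 - 1) * √(c ^ 2 - 1))))
        = (b * c - a) / (√(b ^ 2 - 1) * √(c ^ 2 - 1)) ∧
    Real.sin (Real.arccos ((b * c - a) / (√(b ^ 2 - 1) * √(c ^ 2 - 1))))
        = √(1 + 2 * a * b * c - a ^ 2 - b ^ 2 - c ^ 2) / (√(b ^ 2 - 1) * √(c ^ 2 - 1)) := by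
  have hb2 : 0 < b ^ 2 - 1 := by nlinarith
  have hc2 : 0 < c ^ 2 - 1 := by nlinarith
  have hsb := Real.sqrt_pos.2 hb2
  have hsc := Real.sqrt_pos.2 hc2
  have hP : 0 < √(b ^ 2 - 1) * √(c ^ 2 - 1) := mul_pos hsb hsc
  have hP2 : (√(b ^ 2 - 1) * √(c ^ 2 - 1)) ^ 2 = (b ^ 2 - 1) * (c ^ 2 - 1) := by
    rw [mul_pow, Real.sq_sqrt hb2.le, Real.sq_sqrt hc2.le]
  set P := √(b ^ 2 - 1) * √(c ^ 2 - 1) with hPdef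
  have key : 1 - ((b * c - a) / P) ^ 2
      = (1 + 2 * a * b * c - a ^ 2 - b ^ 2 - c ^ 2) / P ^ 2 := by
    have : P ^ 2 ≠ 0 := by positivity
    field_simp
    rw [hP2]; ring
  have hle : ((b * c - a) / P) ^ 2 ≤ 1 := by
    have : 0 ≤ (1 + 2 * a * b * c - a ^ 2 - b ^ 2 - c ^ 2) / P ^ 2 := by positivity
    linarith
  have h1 := abs_le.1 ((sq_le_one_iff_abs_le_one _).1 hle)
  refine ⟨Real.cos_arccos h1.1 h1.2, ?_⟩
  rw [Real.sin_arccos, key, Real.sqrt_div hD, Real.sqrt_sq hP.le]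

theorem aux_sum (a b c : ℝ) (ha : 1 < a) (hb : 1 < b) (hc : 1 < c)
    (hD : 0 ≤ 1 + 2 * a * b * c - a ^ 2 - b ^ 2 - c ^ 2) :
    |Real.arccos ((b * c - a) / (√(b ^ 2 - 1) * √(c ^ 2 - 1)))
      + Real.arccos ((c * a - b) / (√(c ^ 2 - 1) * √(a ^ 2 - 1)))
      + Real.arccos ((a * b - c) / (√(a ^ 2 - 1) * √(b ^ 2 - 1))) - Real.pi|
    = Real.arccos ((1 + a + b + c) ^ 2 / ((1 + a) * (1 + b) * (1 + c)) - 1) := by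
  obtain ⟨cA, sA⟩ := aux_angle a b c hb hc hD
  obtain ⟨cB, sB⟩ := aux_angle b c a hc ha (by linarith)
  obtain ⟨cC, sC⟩ := aux_angle c a b ha hb (by linarith)
  have eB : 1 + 2 * b * c * a - b ^ 2 - c ^ 2 - a ^ 2
      = 1 + 2 * a * b * c - a ^ 2 - b ^ 2 - c ^ 2 := by ring
  have eC : 1 + 2 * c * a * b - c ^ 2 - a ^ 2 - b ^ 2
      = 1 + 2 * a * b * c - a ^ 2 - b ^ 2 - c ^ 2 := by ring
  rw [eB] at sB
  rw [eC] at sC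
  have ha2 : 0 < a ^ 2 - 1 := by nlinarith
  have hb2 : 0 < b ^ 2 - 1 := by nlinarith
  have hc2 : 0 < c ^ 2 - 1 := by nlinarith
  have hsa := Real.sqrt_pos.2 ha2
  have hsb := Real.sqrt_pos.2 hb2
  have hsc := Real.sqrt_pos.2 hc2
  have qa := Real.sq_sqrt ha2.le
  have qb := Real.sq_sqrt hb2.le
  have qc := Real.sq_sqrt hc2.le
  have qD := Real.sq_sqrt hD
  have hA : 0 ≤ (b * c - a) → Real.arccos ((b * c - a) / (√(b ^ 2 - 1) * √(c ^ 2 - 1)))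
      ≤ Real.pi / 2 := fun h => Real.arccos_le_pi_div_two.2 (by positivity)
  have hB : 0 ≤ (c * a - b) → Real.arccos ((c * a - b) / (√(c ^ 2 - 1) * √(a ^ 2 - 1)))
      ≤ Real.pi / 2 := fun h => Real.arccos_le_pi_div_two.2 (by positivity)
  have hC : 0 ≤ (a * b - c) → Real.arccos ((a * b - c) / (√(a ^ 2 - 1) * √(b ^ 2 - 1)))
      ≤ Real.pi / 2 := fun h => Real.arccos_le_pi_div_two.2 (by positivity)
  have nA := Real.arccos_nonneg ((b * c - a) / (√(b ^ 2 - 1) * √(c ^ 2 - 1)))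
  have nB := Real.arccos_nonneg ((c * a - b) / (√(c ^ 2 - 1) * √(a ^ 2 - 1)))
  have nC := Real.arccos_nonneg ((a * b - c) / (√(a ^ 2 - 1) * √(b ^ 2 - 1)))
  have uA := Real.arccos_le_pi ((b * c - a) / (√(b ^ 2 - 1) * √(c ^ 2 - 1)))
  have uB := Real.arccos_le_pi ((c * a - b) / (√(c ^ 2 - 1) * √(a ^ 2 - 1)))
  have uC := Real.arccos_le_pi ((a * b - c) / (√(a ^ 2 - 1) * √(b ^ 2 - 1)))
  generalize Real.arccos ((b * c - a) / (√(b ^ 2 - 1) * √(c ^ 2 - 1))) = A at *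
  generalize Real.arccos ((c * a - b) / (√(c ^ 2 - 1) * √(a ^ 2 - 1))) = B at *
  generalize Real.arccos ((a * b - c) / (√(a ^ 2 - 1) * √(b ^ 2 - 1))) = C at *
  have hS : A + B + C ≤ 2 * Real.pi := by
    rcases le_or_gt 0 (b * c - a) with h1 | h1
    · rcases le_or_gt 0 (c * a - b) with h2 | h2
      · have := hA h1; have := hB h2; linarith
      · rcases le_or_gt 0 (a * b - c) with h3 | h3
        · have := hA h1; have := hC h3; linarith
        · exfalso
          nlinarith [mul_pos (show 0 < a by linarith) (show 0 < a by linarith)]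
    · rcases le_or_gt 0 (c * a - b) with h2 | h2
      · rcases le_or_gt 0 (a * b - c) with h3 | h3
        · have := hB h2; have := hC h3; linarith
        · exfalso
          nlinarith
      · exfalso
        nlinarith
  have hcos : Real.cos (A + B + C - Real.pi)
      = (1 + a + b + c) ^ 2 / ((1 + a) * (1 + b) * (1 + c)) - 1 := by
    rw [Real.cos_sub_pi, Real.cos_add, Real.cos_add, Real.sin_add, cA, cB, cC, sA, sB, sC]
    generalize √(a ^ 2 - 1) = x at *
    generalize √(b ^ 2 - 1) = y at *
    generalize √(c ^ 2 - 1) = z at *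
    generalize √(1 + 2 * a * b * c - a ^ 2 - b ^ 2 - c ^ 2) = d at *
    have h1 : -(((b * c - a) / (y * z) * ((c * a - b) / (z * x)) - d / (y * z) * (d / (z * x)))
          * ((a * b - c) / (x * y))
        - (d / (y * z) * ((c * a - b) / (z * x)) + (b * c - a) / (y * z) * (d / (z * x)))
          * (d / (x * y)))
      = (d ^ 2 * ((a * b - c) + (c * a - b) + (b * c - a))
          - (b * c - a) * (c * a - b) * (a * b - c)) / (x ^ 2 * y ^ 2 * z ^ 2) := by
      field_simp
      ring
    rw [h1, qa, qb, qc, qD]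
    have : a ^ 2 - 1 ≠ 0 := ha2.ne'
    have : b ^ 2 - 1 ≠ 0 := hb2.ne'
    have : c ^ 2 - 1 ≠ 0 := hc2.ne'
    have : 1 + a ≠ 0 := by positivity
    have : 1 + b ≠ 0 := by positivity
    have : 1 + c ≠ 0 := by positivity
    rw [div_sub_one (by positivity), div_eq_div_iff (by positivity) (by positivity)]
    ring
  rw [← hcos, ← Real.cos_abs]
  refine (Real.arccos_cos (abs_nonneg _) (abs_le.2 ⟨by linarith, by linarith⟩)).symm

theorem aux_gt (I x y : ℝ) (hI : -1 < I) (hx : 0 < x) (hy : 0 < y) : 1 < hypCosh I x y := by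
  have h1 := Real.one_le_cosh (x - y)
  rw [Real.cosh_sub] at h1
  have := mul_pos (Real.sinh_pos_iff.2 hx) (Real.sinh_pos_iff.2 hy)
  unfold hypCosh
  nlinarith

theorem aux_D (I J K x y z : ℝ) (hI : -1 ≤ I) (hI' : I ≤ 1) (hJ : -1 ≤ J) (hJ' : J ≤ 1)
    (hK : -1 ≤ K) (hK' : K ≤ 1) (h1 : 0 ≤ I + J * K) (h2 : 0 ≤ J + K * I) (h3 : 0 ≤ K + I * J)
    (hx : 0 < x) (hy : 0 < y) (hz : 0 < z) :
    0 ≤ 1 + 2 * hypCosh I y z * hypCosh J z x * hypCosh K x y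
      - hypCosh I y z ^ 2 - hypCosh J z x ^ 2 - hypCosh K x y ^ 2 := by
  have sx := Real.sinh_pos_iff.2 hx
  have sy := Real.sinh_pos_iff.2 hy
  have sz := Real.sinh_pos_iff.2 hz
  have cx := Real.cosh_pos x
  have cy := Real.cosh_pos y
  have cz := Real.cosh_pos z
  have ex := Real.cosh_sq x
  have ey := Real.cosh_sq y
  have ez := Real.cosh_sq z
  unfold hypCosh
  generalize Real.sinh x = s at *
  generalize Real.sinh y = t at *
  generalize Real.sinh z = u at *
  generalize Real.cosh x = p at *
  generalize Real.cosh y = q at *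
  generalize Real.cosh z = r at *
  have hI2 : 0 ≤ 1 - I ^ 2 := by nlinarith
  have hJ2 : 0 ≤ 1 - J ^ 2 := by nlinarith
  have hK2 : 0 ≤ 1 - K ^ 2 := by nlinarith
  have hIJK : 0 ≤ 1 + I * J * K := by
    have : |I * J * K| ≤ 1 := by
      rw [abs_mul, abs_mul]
      exact mul_le_one₀ (mul_le_one₀ (abs_le.2 ⟨hI, hI'⟩) (abs_nonneg _) (abs_le.2 ⟨hJ, hJ'⟩))
        (abs_nonneg _) (abs_le.2 ⟨hK, hK'⟩)
    linarith [(abs_le.1 this).1]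
  have key : 1 + 2 * (q * r + I * t * u) * (r * p + J * u * s) * (p * q + K * s * t)
      - (q * r + I * t * u) ^ 2 - (r * p + J * u * s) ^ 2 - (p * q + K * s * t) ^ 2
      = (1 - I ^ 2) * (t ^ 2 * u ^ 2) + (1 - J ^ 2) * (u ^ 2 * s ^ 2)
        + (1 - K ^ 2) * (s ^ 2 * t ^ 2) + 2 * (1 + I * J * K) * (s ^ 2 * t ^ 2 * u ^ 2)
        + 2 * (I + J * K) * (s ^ 2 * t * u * q * r) + 2 * (J + K * I) * (t ^ 2 * u * s * r * p)
        + 2 * (K + I * J) * (u ^ 2 * s * t * p * q) := by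
    have e1 : s ^ 2 = p ^ 2 - 1 := by linarith
    have e2 : t ^ 2 = q ^ 2 - 1 := by linarith
    have e3 : u ^ 2 = r ^ 2 - 1 := by linarith
    ring_nf
    simp only [e1, e2, e3]
    ring_nf
  rw [key]
  positivity

theorem stmt_15 (Θi Θj Θk : ℝ)
    (hi0 : 0 ≤ Θi) (hi1 : Θi < Real.pi)
    (hj0 : 0 ≤ Θj) (hj1 : Θj < Real.pi)
    (hk0 : 0 ≤ Θk) (hk1 : Θk < Real.pi)
    (hξi : 0 ≤ Real.cos Θi + Real.cos Θj * Real.cos Θk)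
    (hξj : 0 ≤ Real.cos Θj + Real.cos Θk * Real.cos Θi)
    (hξk : 0 ≤ Real.cos Θk + Real.cos Θi * Real.cos Θj) :
    Filter.Tendsto
      (fun p : ℝ × ℝ × ℝ =>
        hypAngle (Real.cos Θi) (Real.cos Θj) (Real.cos Θk) p.1 p.2.1 p.2.2
          + hypAngle (Real.cos Θj) (Real.cos Θk) (Real.cos Θi) p.2.1 p.2.2 p.1
          + hypAngle (Real.cos Θk) (Real.cos Θi) (Real.cos Θj) p.2.2 p.1 p.2.1)
      (nhdsWithin (0, 0, 0) (Set.Ioi 0 ×ˢ Set.Ioi 0 ×ˢ Set.Ioi 0))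
      (nhds Real.pi) := by

  have neg : ∀ θ : ℝ, 0 ≤ θ → θ < Real.pi → -1 < Real.cos θ := fun θ h0 h1 => by
    have := Real.cos_lt_cos_of_nonneg_of_le_pi h0 le_rfl h1
    rwa [Real.cos_pi] at this
  have ni := neg Θi hi0 hi1
  have nj := neg Θj hj0 hj1
  have nk := neg Θk hk0 hk1
  have ui := Real.cos_le_one Θi
  have uj := Real.cos_le_one Θj
  have uk := Real.cos_le_one Θk
  generalize Real.cos Θi = I at *
  generalize Real.cos Θj = J at *
  generalize Real.cos Θk = K at *
  rw [tendsto_iff_dist_tendsto_zero]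
  let F : ℝ × ℝ × ℝ → ℝ := fun p => Real.arccos
    ((1 + hypCosh I p.2.1 p.2.2 + hypCosh J p.2.2 p.1 + hypCosh K p.1 p.2.1) ^ 2 /
      ((1 + hypCosh I p.2.1 p.2.2) * (1 + hypCosh J p.2.2 p.1) * (1 + hypCosh K p.1 p.2.1)) - 1)
  have hF0 : F (0, 0, 0) = 0 := by
    simp only [F, hypCosh, Real.cosh_zero, Real.sinh_zero]
    norm_num
  have hFc : ContinuousAt F (0, 0, 0) := by
    refine Real.continuous_arccos.continuousAt.comp ?_
    unfold hypCosh
    refine ContinuousAt.sub (ContinuousAt.div ?_ ?_ ?_) continuousAt_const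
    · fun_prop
    · fun_prop
    · norm_num
  have hF : Filter.Tendsto F
      (nhdsWithin (0, 0, 0) (Set.Ioi 0 ×ˢ Set.Ioi 0 ×ˢ Set.Ioi 0)) (nhds 0) := by
    have := hFc.tendsto
    rw [hF0] at this
    exact this.mono_left nhdsWithin_le_nhds
  refine hF.congr' ?_
  filter_upwards [self_mem_nhdsWithin] with p hp
  obtain ⟨x, y, z⟩ := p
  obtain ⟨hx, hy, hz⟩ := hp
  simp only [Set.mem_Ioi] at hx hy hz
  rw [Real.dist_eq]
  exact (aux_sum _ _ _ (aux_gt I y z ni hy hz) (aux_gt J z x nj hz hx) (aux_gt K x y nk hx hy)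
    (aux_D I J K x y z ni.le ui nj.le uj nk.le uk hξi hξj hξk hx hy hz)).symm
end
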